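/- Let ℂⁿ = H_S ⊕ H_R be an orthogonal decomposition with orthogonal projections Π_S and Π_R = I − Π_S. Let L_1, …, L_r ∈ M_n(ℂ) satisfy Π_S L_k Π_R = 0 and Π_R L_k Π_S = 0 for every k (all noise operators block diagonal). Then for every Hermitian H ∈ M_n(ℂ) such that H_S is invariant for the master equation with Lindblad generator 𝓛 built from H and L_1,…,L_r (i.e. Π_R L_k Π_S = 0 for all k and Π_S(i·H − (1/2)Σ_k L_k† L_k)Π_R = 0), one has Π_S H Π_R = 0, and the subspace H_R is also invariant: for every density matrix ρ supported in H_R and every t ≥ 0, exp(t𝓛)(ρ) is supported in H_R; in particular trace(Π_S · exp(t𝓛)(ρ)) = 0 for all t ≥ 0, so H_S is not attractive. -/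

import Mathlib

open scoped Matrix ComplexOrder

noncomputable section

attribute [local instance] Matrix.normedAddCommGroup Matrix.normedSpace

abbrev Mat (n : ℕ) := Matrix (Fin n) (Fin n) ℂ

/-- The Lindblad generator `𝓛(ρ) = −i[H,ρ] + Σ_k (L_k ρ L_k† − ½(L_k† L_k ρ + ρ L_k† L_k))`. -/
def lindblad {n r : ℕ} (H : Mat n) (L : Fin r → Mat n) : Mat n →ₗ[ℂ] Mat n :=
  (-Complex.I) • (LinearMap.mulLeft ℂ H - LinearMap.mulRight ℂ H)
    + ∑ k, ((LinearMap.mulRight ℂ (L k)ᴴ).comp (LinearMap.mulLeft ℂ (L k))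
        - (1/2 : ℂ) • (LinearMap.mulLeft ℂ ((L k)ᴴ * L k)
            + LinearMap.mulRight ℂ ((L k)ᴴ * L k)))

/-- `evol H L t ρ = exp (t 𝓛) ρ`, the solution of the master equation at time `t`. -/
def evol {n r : ℕ} (H : Mat n) (L : Fin r → Mat n) (t : ℝ) (ρ : Mat n) : Mat n :=
  haveI : IsTopologicalRing (Mat n →L[ℂ] Mat n) := by
    let _ : SeminormedRing (Mat n →L[ℂ] Mat n) :=
      @ContinuousLinearMap.toSeminormedRing ℂ (Mat n) _ _ _
    exact @NonUnitalSeminormedRing.toIsTopologicalRing (Mat n →L[ℂ] Mat n) _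
  NormedSpace.exp ((t : ℂ) • (lindblad H L).toContinuousLinearMap) ρ

/-- An element whose off-diagonal blocks with respect to `p` vanish commutes with `p`. -/
theorem commute_of_offDiagonal_eq_zero {R : Type*} [Ring R] {p a : R}
    (hpa : p * a * (1 - p) = 0) (hap : (1 - p) * a * p = 0) : Commute p a := by
  have h₁ : p * a = p * a * p := by
    rw [mul_sub, mul_one] at hpa
    exact sub_eq_zero.mp hpa
  have h₂ : a * p = p * a * p := by
    rw [sub_mul, sub_mul, one_mul] at hap
    exact sub_eq_zero.mp hap
  exact h₁.trans h₂.symm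

/-- Compression by a matrix commuting with the Hamiltonian, the noise operators and their adjoints
commutes with the Lindblad generator. -/
theorem lindblad_compression {n r : ℕ} {H Q : Mat n} {L : Fin r → Mat n} (hH : Commute Q H)
    (hL : ∀ k, Commute Q (L k)) (hL' : ∀ k, Commute Q (L k)ᴴ) (X : Mat n) :
    lindblad H L (Q * X * Q) = Q * lindblad H L X * Q := by
  have left {A : Mat n} (hA : Commute Q A) : A * (Q * X * Q) = Q * (A * X) * Q := by
    simp only [← mul_assoc, hA.eq]
  have right {A : Mat n} (hA : Commute Q A) (Y : Mat n) : Q * Y * Q * A = Q * (Y * A) * Q := by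
    simp only [mul_assoc, hA.eq]
  simp only [lindblad, LinearMap.add_apply, LinearMap.smul_apply, LinearMap.sub_apply,
    LinearMap.sum_apply, LinearMap.comp_apply, LinearMap.mulLeft_apply, LinearMap.mulRight_apply,
    left hH, right hH, left (hL _), right (hL' _), left ((hL' _).mul_right (hL _)),
    right ((hL' _).mul_right (hL _)), mul_add, add_mul, mul_sub, sub_mul, Finset.mul_sum,
    Finset.sum_mul, mul_smul_comm, smul_mul_assoc, smul_add, smul_sub]

/-- The evolution commutes with every compression that commutes with the generator. -/
theorem evol_compression {n r : ℕ} {H Q : Mat n} {L : Fin r → Mat n}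
    (h : ∀ X, lindblad H L (Q * X * Q) = Q * lindblad H L X * Q) (t : ℝ) (X : Mat n) :
    evol H L t (Q * X * Q) = Q * evol H L t X * Q := by
  let C : Mat n →L[ℂ] Mat n :=
    ((LinearMap.mulRight ℂ Q).comp (LinearMap.mulLeft ℂ Q)).toContinuousLinearMap
  have hC : Commute C ((t : ℂ) • (lindblad H L).toContinuousLinearMap) := by
    refine ContinuousLinearMap.ext fun Y => ?_
    change Q * ((t : ℂ) • lindblad H L Y) * Q = (t : ℂ) • lindblad H L (Q * Y * Q)
    rw [h, mul_smul_comm, smul_mul_assoc]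
  have : IsTopologicalRing (Mat n →L[ℂ] Mat n) := by
    let _ : SeminormedRing (Mat n →L[ℂ] Mat n) :=
      @ContinuousLinearMap.toSeminormedRing ℂ (Mat n) _ _ _
    exact @NonUnitalSeminormedRing.toIsTopologicalRing (Mat n →L[ℂ] Mat n) _
  exact (DFunLike.congr_fun hC.exp_right.eq X).symm

/-- If all noise operators are block diagonal, then any Hermitian `H`
making `H_S` invariant must satisfy `Π_S H Π_R = 0`, and `H_R` is then invariant as well:
solutions starting in `H_R` stay supported in `H_R` and `tr(Π_S exp(t𝓛)(ρ)) = 0`,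
so `H_S` is not attractive. -/
theorem block_diagonal_noise_R_invariant {n r : ℕ}
    (PS : Mat n) (hPH : PS.IsHermitian) (hPidem : PS * PS = PS)
    (L : Fin r → Mat n)
    (hLP : ∀ k, PS * L k * (1 - PS) = 0)
    (hLQ : ∀ k, (1 - PS) * L k * PS = 0) :
    ∀ H : Mat n, H.IsHermitian →
      PS * (Complex.I • H - (1/2 : ℂ) • ∑ k, (L k)ᴴ * L k) * (1 - PS) = 0 →
      PS * H * (1 - PS) = 0 ∧
      ∀ ρ : Mat n, ρ.PosSemidef → ρ.trace = 1 → (1 - PS) * ρ * (1 - PS) = ρ →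
        ∀ t : ℝ, 0 ≤ t →
          (1 - PS) * evol H L t ρ * (1 - PS) = evol H L t ρ ∧
          (PS * evol H L t ρ).trace = 0 := by
  intro H hH hinv
  have hPL (k) : Commute PS (L k) := commute_of_offDiagonal_eq_zero (hLP k) (hLQ k)
  have hPL' (k) : Commute PS (L k)ᴴ := by
    have h := congrArg Matrix.conjTranspose (hPL k).eq
    rw [Matrix.conjTranspose_mul, Matrix.conjTranspose_mul, hPH.eq] at h
    exact h.symm
  have hcompl : PS * (1 - PS) = 0 := by rw [mul_sub, mul_one, hPidem, sub_self]
  have hsum : PS * (∑ k, (L k)ᴴ * L k) * (1 - PS) = 0 := by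
    have hc : Commute PS (∑ k, (L k)ᴴ * L k) :=
      Commute.sum_right _ _ _ fun k _ => (hPL' k).mul_right (hPL k)
    rw [hc.eq, mul_assoc, hcompl, mul_zero]
  have hoff : PS * H * (1 - PS) = 0 := by
    rw [mul_sub PS, sub_mul, mul_smul_comm, smul_mul_assoc, mul_smul_comm, smul_mul_assoc, hsum,
      smul_zero, sub_zero] at hinv
    exact (smul_eq_zero.mp hinv).resolve_left Complex.I_ne_zero
  refine ⟨hoff, fun ρ _ _ hρ t _ => ?_⟩
  have hoff' : (1 - PS) * H * PS = 0 := by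
    have h := congrArg Matrix.conjTranspose hoff
    rwa [Matrix.conjTranspose_mul, Matrix.conjTranspose_mul, Matrix.conjTranspose_sub,
      Matrix.conjTranspose_one, hPH.eq, hH.eq, Matrix.conjTranspose_zero, ← mul_assoc] at h
  have hQ {A : Mat n} (hA : Commute PS A) : Commute (1 - PS) A :=
    (Commute.one_left A).sub_left hA
  have hsupp : (1 - PS) * evol H L t ρ * (1 - PS) = evol H L t ρ := by
    rw [← evol_compression (lindblad_compression (hQ (commute_of_offDiagonal_eq_zero hoff hoff'))
      (fun k => hQ (hPL k)) fun k => hQ (hPL' k)), hρ]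
  refine ⟨hsupp, ?_⟩
  rw [← hsupp, ← mul_assoc, ← mul_assoc, hcompl, zero_mul, zero_mul, Matrix.trace_zero]
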